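/- Let Ω be a finite scenario set with probabilities π : Ω → ℝ satisfying π_ω ≥ 0 for all ω and ∑_{ω∈Ω} π_ω = 1. Let the first-stage decisions live in ℝⁿ; for each ω ∈ Ω let Y_ω be a type of second-stage decisions, S_ω ⊆ ℝⁿ × Y_ω a constraint set, C_inv : ℝⁿ → ℝ the investment cost, C_ω : Y_ω → ℝ the scenario operation cost, C a finite index set, and σ : C → Ω → ℝⁿ × Y_ω → ℝ slack functions. Call (x, (y_ω)_{ω}) EF-feasible if (x, y_ω) ∈ S_ω for every ω and ∑_{ω∈Ω} π_ω σ_{c,ω}(x, y_ω) ≤ 0 for every c ∈ C. Then for every λ : C → ℝ with λ ≥ 0 componentwise and every w : Ω → ℝⁿ with ∑_{ω∈Ω} π_ω w_ω = 0, assuming each per-scenario infimum below is finite, the quantity ∑_{ω∈Ω} π_ω · inf_{(x,y)∈S_ω} [ C_inv(x) + C_ω(y) + ⟨w_ω, x⟩ + ∑_{c∈C} λ_c σ_{c,ω}(x,y) ] is at most C_inv(x*) + ∑_{ω∈Ω} π_ω C_ω(y*_ω) for every EF-feasible point (x*, (y*_ω)_ω); i.e., simultaneously dualizing the nonanticipativity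 constraints with multipliers w and the expectation constraints with multipliers λ yields a valid lower bound on the optimal EF value. -/

import Mathlib

/-- Simultaneously dualizing the nonanticipativity constraints (multipliers `w`
with `∑ ω, π ω • w ω = 0`) and the expectation constraints (multipliers `λ ≥ 0`)
yields a valid lower bound on the optimal value of the two-stage extensive form. -/
theorem augmented_lagrangian_lower_bound
    {Ω C : Type*} [Fintype Ω] [Fintype C] {n : ℕ}
    (π : Ω → ℝ) (hπ0 : ∀ ω, 0 ≤ π ω) (hπ1 : ∑ ω, π ω = 1)
    (Y : Ω → Type*) (S : ∀ ω, Set ((Fin n → ℝ) × Y ω))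
    (Cinv : (Fin n → ℝ) → ℝ) (Cop : ∀ ω, Y ω → ℝ)
    (σ : ∀ _ : C, ∀ ω, (Fin n → ℝ) × Y ω → ℝ)
    (lam : C → ℝ) (hlam : ∀ c, 0 ≤ lam c)
    (w : Ω → Fin n → ℝ) (hw : ∑ ω, π ω • w ω = 0)
    (hfin : ∀ ω,
      {v : ℝ | ∃ p ∈ S ω, v = Cinv p.1 + Cop ω p.2 + (∑ i, w ω i * p.1 i) +
        ∑ c, lam c * σ c ω p}.Nonempty ∧
      BddBelow {v : ℝ | ∃ p ∈ S ω, v = Cinv p.1 + Cop ω p.2 + (∑ i, w ω i * p.1 i) +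
        ∑ c, lam c * σ c ω p})
    (xs : Fin n → ℝ) (ys : ∀ ω, Y ω)
    (hfeasS : ∀ ω, (xs, ys ω) ∈ S ω)
    (hfeasE : ∀ c, ∑ ω, π ω * σ c ω (xs, ys ω) ≤ 0) :
    (∑ ω, π ω * sInf {v : ℝ | ∃ p ∈ S ω,
        v = Cinv p.1 + Cop ω p.2 + (∑ i, w ω i * p.1 i) + ∑ c, lam c * σ c ω p})
      ≤ Cinv xs + ∑ ω, π ω * Cop ω (ys ω) := by
  have h1 : ∑ ω, π ω * (∑ i, w ω i * xs i) = 0 := by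
    have hi : ∀ i, ∑ ω, π ω * w ω i = 0 := fun i => by
      have := congrFun hw i
      simpa [Finset.sum_apply] using this
    simp_rw [Finset.mul_sum]
    rw [Finset.sum_comm]
    refine Finset.sum_eq_zero fun i _ => ?_
    simp_rw [← mul_assoc]
    rw [← Finset.sum_mul, hi, zero_mul]
  have h2 : ∑ ω, π ω * (∑ c, lam c * σ c ω (xs, ys ω)) ≤ 0 := by
    simp_rw [Finset.mul_sum]
    rw [Finset.sum_comm]
    refine Finset.sum_nonpos fun c _ => ?_
    simp_rw [mul_left_comm _ (lam c)]
    rw [← Finset.mul_sum]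
    exact mul_nonpos_of_nonneg_of_nonpos (hlam c) (hfeasE c)
  have h3 : ∑ ω, π ω * Cinv xs = Cinv xs := by
    rw [← Finset.sum_mul, hπ1, one_mul]
  refine (Finset.sum_le_sum fun ω _ => mul_le_mul_of_nonneg_left
    (csInf_le (hfin ω).2 ⟨(xs, ys ω), hfeasS ω, rfl⟩) (hπ0 ω)).trans ?_
  simp only [mul_add, Finset.sum_add_distrib]
  linarith
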